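/- arXiv:0909.3485 — 2 statements merged into one kernel-verified Lean document; each statement's English description precedes it below -/
import Mathlib

section
/- Basic Perturbation Lemma: Let (f,g,h) : A ⇒ B be a contraction of chain complexes over k, and let t be a perturbation of A such that 1_A − ht is invertible as a degree-0 k-linear map. Set Σ = t(1_A − ht)^{−1} and f' = f + fΣh, g' = g + hΣg, h' = h + hΣh, t' = fΣg. Then t' is a perturbation of B, and (f', g', h') is a contraction from A^t to B^{t'}: f' and g' are chain maps with respect to the perturbed differentials d_A + t and d_B + t', f'g' = 1_B, (d_A+t)h' + h'(d_A+t) = g'f' − 1_A, and f'h' = 0, h'g' = 0, h'h' = 0. -/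
open scoped TensorProduct DirectSum

/-- A `ℤ`-graded `k`-module. -/
structure GradedModule (k : Type) [CommRing k] where
  M : ℤ → Type
  [acg : ∀ i, AddCommGroup (M i)]
  [mod : ∀ i, Module k (M i)]

attribute [instance] GradedModule.acg GradedModule.mod

variable {k : Type} [CommRing k]

/-- Graded `k`-linear maps of degree `r`. -/
abbrev GMap (A B : GradedModule k) (r : ℤ) := ∀ i : ℤ, A.M i →ₗ[k] B.M (i + r)

/-- Transport along an equality of degrees. -/
def GradedModule.cast (A : GradedModule k) {i j : ℤ} (h : i = j) : A.M i ≃ₗ[k] A.M j := by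
  subst h; exact LinearEquiv.refl k (A.M i)

/-- Recast the degree of a graded map. -/
def GMap.cast {A B : GradedModule k} {r s : ℤ} (h : r = s) (f : GMap A B r) : GMap A B s :=
  fun i => (B.cast (by rw [h])).toLinearMap ∘ₗ f i

/-- Recast the degree of a graded map, with the degree equation discharged automatically. -/
def dcast {A B : GradedModule k} {r s : ℤ} (f : GMap A B r) (h : r = s := by norm_num) :
    GMap A B s := GMap.cast h f

/-- Composition of graded maps (`gcomp g f = g ∘ f`, so `f` acts first). -/
def gcomp {A B C : GradedModule k} {r s : ℤ} (g : GMap B C s) (f : GMap A B r) :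
    GMap A C (r + s) :=
  fun i => (C.cast (add_assoc i r s)).toLinearMap ∘ₗ g (i + r) ∘ₗ f i

/-- The identity graded map. -/
def gid (A : GradedModule k) : GMap A A 0 := fun i => (A.cast (add_zero i).symm).toLinearMap

/-- The sign `(-1)^r`. -/
def gsign (r : ℤ) : ℤ := (-1) ^ r.natAbs

/-- An (unbounded) chain complex of `k`-modules: the differential has degree `-1`. -/
structure Cplx (k : Type) [CommRing k] extends GradedModule k where
  d : GMap toGradedModule toGradedModule (-1)
  d_sq : gcomp d d = 0

/-- The differential `∂(f) = d∘f - (-1)^{|f|} f∘d` on graded maps between chain complexes. -/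
def gdiff {A B : Cplx k} {r : ℤ} (f : GMap A.toGradedModule B.toGradedModule r) :
    GMap A.toGradedModule B.toGradedModule (r - 1) :=
  GMap.cast (by ring) (gcomp B.d f) - gsign r • GMap.cast (by ring) (gcomp f A.d)

/-- A perturbation of the chain complex `A`: a degree `-1` map `t` with `(d+t)² = 0`. -/
def IsPerturbation (A : Cplx k) (t : GMap A.toGradedModule A.toGradedModule (-1)) : Prop :=
  gcomp (A.d + t) (A.d + t) = 0

/-- A contraction (SDR-data) of chain complexes. -/
structure Contraction (A B : Cplx k) where
  f : GMap A.toGradedModule B.toGradedModule 0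
  g : GMap B.toGradedModule A.toGradedModule 0
  h : GMap A.toGradedModule A.toGradedModule 1
  f_chain : gdiff f = 0
  g_chain : gdiff g = 0
  fg : gcomp f g = gid B.toGradedModule
  homotopy : gdiff h = dcast (gcomp g f) - dcast (gid A.toGradedModule)
  fh : gcomp f h = 0
  hg : gcomp h g = 0
  hh : gcomp h h = 0

/-- A section of the family `A.M` is compatible with transport of degrees. -/
theorem GradedModule.cast_section (A : GradedModule k) {i j : ℤ} (h : i = j) (x : ∀ i, A.M i) :
    A.cast h (x i) = x j := by
  subst h; rfl

namespace GMap

variable {A B C : GradedModule k} {r s : ℤ}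

/-- Graded maps commute with transport of degrees. -/
theorem apply_cast (f : GMap A B r) {i j : ℤ} (h : i = j) (x : A.M i) :
    f j (A.cast h x) = B.cast (congrArg (· + r) h) (f i x) := by
  subst h; rfl

/-- The linear map induced by a graded map on the products of all homogeneous components. -/
def total (f : GMap A B r) : (∀ i, A.M i) →ₗ[k] (∀ i, B.M i) :=
  LinearMap.pi fun j =>
    (B.cast (sub_add_cancel j r)).toLinearMap ∘ₗ f (j - r) ∘ₗ LinearMap.proj (j - r)

theorem total_apply_add (f : GMap A B r) (x : ∀ i, A.M i) (i : ℤ) :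
    f.total x (i + r) = f i (x i) := by
  rw [← A.cast_section (add_sub_cancel_right i r) x, apply_cast]
  rfl

theorem linearMap_ext_add (r : ℤ) {F G : (∀ i, A.M i) →ₗ[k] (∀ i, B.M i)}
    (h : ∀ x i, F x (i + r) = G x (i + r)) : F = G := by
  refine LinearMap.ext fun x => funext fun j => ?_
  obtain ⟨i, rfl⟩ : ∃ i, j = i + r := ⟨j - r, by ring⟩
  exact h x i

theorem total_injective : Function.Injective (total : GMap A B r → _) := by
  intro f g h
  refine funext fun i => LinearMap.ext fun x => ?_
  have := congrFun (LinearMap.congr_fun h (Pi.single i x)) (i + r)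
  simpa [total_apply_add] using this

theorem total_zero : (0 : GMap A B r).total = 0 :=
  linearMap_ext_add r fun x i => by rw [total_apply_add]; rfl

theorem total_add (f g : GMap A B r) : (f + g).total = f.total + g.total :=
  linearMap_ext_add r fun x i => by
    simp only [total_apply_add, LinearMap.add_apply, Pi.add_apply]

theorem total_sub (f g : GMap A B r) : (f - g).total = f.total - g.total :=
  linearMap_ext_add r fun x i => by
    simp only [total_apply_add, LinearMap.sub_apply, Pi.sub_apply]

theorem total_zsmul (n : ℤ) (f : GMap A B r) : (n • f).total = n • f.total :=
  linearMap_ext_add r fun x i => by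
    simp only [total_apply_add, LinearMap.smul_apply, Pi.smul_apply]

theorem total_cast (h : r = s) (f : GMap A B r) : (GMap.cast h f).total = f.total := by
  subst h; rfl

theorem total_dcast (h : r = s) (f : GMap A B r) : (dcast f h).total = f.total :=
  total_cast h f

theorem total_gid : (gid A).total = LinearMap.id :=
  linearMap_ext_add 0 fun x i => by
    rw [total_apply_add]
    exact A.cast_section (add_zero i).symm x

theorem total_gcomp (g : GMap B C s) (f : GMap A B r) :
    (gcomp g f).total = g.total ∘ₗ f.total :=
  linearMap_ext_add (r + s) fun x i => by
    rw [total_apply_add, LinearMap.comp_apply,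
      ← C.cast_section (add_assoc i r s) (g.total (f.total x)), total_apply_add, total_apply_add]
    rfl

end GMap

theorem total_gdiff {A B : Cplx k} {r : ℤ} (f : GMap A.toGradedModule B.toGradedModule r) :
    (gdiff f).total = B.d.total ∘ₗ f.total - gsign r • (f.total ∘ₗ A.d.total) := by
  simp only [gdiff, GMap.total_sub, GMap.total_zsmul, GMap.total_cast, GMap.total_gcomp]

section Ungraded

variable {M N : Type*} [AddCommGroup M] [Module k M] [AddCommGroup N] [Module k N]

/-- The basic perturbation lemma for ungraded differential modules. -/
theorem LinearMap.basic_perturbation {d t h v S : M →ₗ[k] M} {e : N →ₗ[k] N}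
    {f : M →ₗ[k] N} {g : N →ₗ[k] M}
    (hd : d ∘ₗ d = 0) (he : e ∘ₗ e = 0) (hf : e ∘ₗ f = f ∘ₗ d) (hg : d ∘ₗ g = g ∘ₗ e)
    (fg : f ∘ₗ g = .id) (dh : d ∘ₗ h + h ∘ₗ d = g ∘ₗ f - .id)
    (fh : f ∘ₗ h = 0) (hg0 : h ∘ₗ g = 0) (hh : h ∘ₗ h = 0)
    (ht : (d + t) ∘ₗ (d + t) = 0)
    (hv1 : (.id - h ∘ₗ t) ∘ₗ v = .id) (hv2 : v ∘ₗ (.id - h ∘ₗ t) = .id) (hS : S = t ∘ₗ v) :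
    (e + f ∘ₗ S ∘ₗ g) ∘ₗ (e + f ∘ₗ S ∘ₗ g) = 0 ∧
    (e + f ∘ₗ S ∘ₗ g) ∘ₗ (f + f ∘ₗ S ∘ₗ h) = (f + f ∘ₗ S ∘ₗ h) ∘ₗ (d + t) ∧
    (d + t) ∘ₗ (g + h ∘ₗ S ∘ₗ g) = (g + h ∘ₗ S ∘ₗ g) ∘ₗ (e + f ∘ₗ S ∘ₗ g) ∧
    (f + f ∘ₗ S ∘ₗ h) ∘ₗ (g + h ∘ₗ S ∘ₗ g) = .id ∧
    (d + t) ∘ₗ (h + h ∘ₗ S ∘ₗ h) + (h + h ∘ₗ S ∘ₗ h) ∘ₗ (d + t)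
      = (g + h ∘ₗ S ∘ₗ g) ∘ₗ (f + f ∘ₗ S ∘ₗ h) - .id ∧
    (f + f ∘ₗ S ∘ₗ h) ∘ₗ (h + h ∘ₗ S ∘ₗ h) = 0 ∧
    (h + h ∘ₗ S ∘ₗ h) ∘ₗ (g + h ∘ₗ S ∘ₗ g) = 0 ∧
    (h + h ∘ₗ S ∘ₗ h) ∘ₗ (h + h ∘ₗ S ∘ₗ h) = 0 := by
  simp only [LinearMap.ext_iff, LinearMap.comp_apply, LinearMap.add_apply, LinearMap.sub_apply,
    LinearMap.id_apply, LinearMap.zero_apply, map_add, map_sub] at *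
  have v_eq x : v x = x + h (S x) := by rw [hS, ← sub_eq_iff_eq_add]; exact hv1 x
  have S_left x : t (h (S x)) = S x - t x := by
    have := congrArg t (v_eq x)
    rw [← hS, map_add] at this
    exact eq_sub_of_add_eq' this.symm
  have S_right x : S (h (t x)) = S x - t x := by
    rw [hS, hS, ← map_sub]; congr 1; exact (sub_eq_of_eq_add' (sub_eq_iff_eq_add.1 (hv2 x))).symm
  have dh' x : d (h x) = g (f x) - x - h (d x) := eq_sub_of_add_eq (dh x)
  have td x : t (d x) = - d (t x) - t (t x) := by
    have := ht x
    rw [hd, zero_add] at this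
    linear_combination (norm := abel) this
  have key x : S (g (f (S x))) = - S (d x) - d (S x) := by
    have h₁ := congrArg S (dh (S x))
    have h₂ := congrArg (fun y => S (d y)) (v_eq x)
    have h₃ := S_right (d (v x))
    have h₄ := S_right (t (v x))
    simp only [td, ← hS, map_add, map_sub, map_neg] at h₁ h₂ h₃ h₄
    linear_combination (norm := abel) - h₁ - h₂ - h₃ - h₄
  refine ⟨fun x => ?_, fun x => ?_, fun x => ?_, fun x => ?_, fun x => ?_, fun x => ?_,
    fun x => ?_, fun x => ?_⟩
  all_goals
    simp only [he, hf, hg, fg, fh, hg0, hh, dh', key, S_left, S_right, map_sub, map_neg, map_zero]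
    try abel

end Ungraded

/-- **Basic Perturbation Lemma** (Brown, Gugenheim).
Given a contraction `(f,g,h) : A ⇒ B`, a perturbation `t` of `A` such that `1 - h∘t` has a
two-sided inverse `v` among degree-0 graded maps, set `Σ = t∘v` and
`f' = f + f∘Σ∘h`, `g' = g + h∘Σ∘g`, `h' = h + h∘Σ∘h`, `t' = f∘Σ∘g`.  Then `t'` is a
perturbation of `B`, `f'` and `g'` are chain maps for the perturbed differentials
`d_A + t` and `d_B + t'`, `f'∘g' = 1_B`, `(d_A+t)∘h' + h'∘(d_A+t) = g'∘f' - 1_A`, and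
`f'∘h' = 0`, `h'∘g' = 0`, `h'∘h' = 0`. -/
theorem basic_perturbation_lemma (A B : Cplx k) (C : Contraction A B)
    (t : GMap A.toGradedModule A.toGradedModule (-1)) (ht : IsPerturbation A t)
    (v : GMap A.toGradedModule A.toGradedModule 0)
    (hv1 : gcomp (gid A.toGradedModule - dcast (gcomp C.h t)) v = dcast (gid A.toGradedModule))
    (hv2 : gcomp v (gid A.toGradedModule - dcast (gcomp C.h t)) = dcast (gid A.toGradedModule))
    (Sg : GMap A.toGradedModule A.toGradedModule (-1)) (hSg : Sg = dcast (gcomp t v))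
    (f' : GMap A.toGradedModule B.toGradedModule 0)
    (hf' : f' = C.f + dcast (gcomp C.f (gcomp Sg C.h)))
    (g' : GMap B.toGradedModule A.toGradedModule 0)
    (hg' : g' = C.g + dcast (gcomp C.h (gcomp Sg C.g)))
    (h' : GMap A.toGradedModule A.toGradedModule 1)
    (hh' : h' = C.h + dcast (gcomp C.h (gcomp Sg C.h)))
    (t' : GMap B.toGradedModule B.toGradedModule (-1))
    (ht' : t' = dcast (gcomp C.f (gcomp Sg C.g))) :
    -- `t'` is a perturbation of `B`
    IsPerturbation B t' ∧
    -- `f'` and `g'` are chain maps with respect to the perturbed differentials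
    gcomp (B.d + t') f' = dcast (gcomp f' (A.d + t)) ∧
    gcomp (A.d + t) g' = dcast (gcomp g' (B.d + t')) ∧
    -- `(f',g',h')` is a contraction from `A^t` to `B^{t'}`
    gcomp f' g' = dcast (gid B.toGradedModule) ∧
    dcast (gcomp (A.d + t) h') + dcast (gcomp h' (A.d + t))
      = dcast (gcomp g' f') - gid A.toGradedModule ∧
    gcomp f' h' = 0 ∧ gcomp h' g' = 0 ∧ gcomp h' h' = 0 := by
  have hd := congrArg GMap.total A.d_sq
  have he := congrArg GMap.total B.d_sq
  have hf := congrArg GMap.total C.f_chain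
  have hg := congrArg GMap.total C.g_chain
  have fg := congrArg GMap.total C.fg
  have dh := congrArg GMap.total C.homotopy
  have fh := congrArg GMap.total C.fh
  have hg0 := congrArg GMap.total C.hg
  have hh := congrArg GMap.total C.hh
  replace ht := congrArg GMap.total ht
  replace hv1 := congrArg GMap.total hv1
  replace hv2 := congrArg GMap.total hv2
  replace hSg := congrArg GMap.total hSg
  subst hf' hg' hh' ht'
  simp only [total_gdiff, gsign, GMap.total_gcomp, GMap.total_add, GMap.total_sub, GMap.total_dcast,
    GMap.total_gid, GMap.total_zero] at hd he hf hg fg dh fh hg0 hh ht hv1 hv2 hSg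
  norm_num [sub_eq_zero] at hf hg dh
  simp only [IsPerturbation, ← GMap.total_injective.eq_iff, GMap.total_gcomp, GMap.total_add,
    GMap.total_sub, GMap.total_dcast, GMap.total_gid, GMap.total_zero]
  exact LinearMap.basic_perturbation hd he hf hg fg dh fh hg0 hh ht hv1 hv2 hSg
end

section
/- For all non-negative integers r, k, n with r + k < n, the following identity holds in ℚ: Σ_{j=0}^{r} C(r,j) · (j+k)!(n−1−j−k)!/n! = k!(n−r−1−k)!/(n−r)!, where C(r,j) is the binomial coefficient. Equivalently, with c(m,l) = l!(m−1−l)!/m! for l < m, one has Σ_{j=0}^{r} C(r,j) c(n, j+k) = c(n−r, k). -/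
/-- The coefficients `c(m,l) = l!(m-1-l)!/m!` (for `l < m`, and `0` otherwise). -/
noncomputable def coefC (m l : ℕ) : ℚ :=
  if l < m then (Nat.factorial l * Nat.factorial (m - 1 - l) : ℚ) / Nat.factorial m else 0

/-- The value of `coefC` inside its range, without natural-number subtraction. -/
theorem coefC_add_add_one (l d : ℕ) :
    coefC (l + d + 1) l = (l.factorial * d.factorial : ℚ) / (l + d + 1).factorial := by
  have hlt : l < l + d + 1 := by omega
  have hsub : l + d + 1 - 1 - l = d := by omega
  rw [coefC, if_pos hlt, hsub]

theorem coefC_add_coefC_succ {m l : ℕ} (h : l < m) :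
    coefC (m + 1) l + coefC (m + 1) (l + 1) = coefC m l := by
  obtain ⟨d, rfl⟩ := Nat.exists_eq_add_of_lt h
  have h₁ := coefC_add_add_one l (d + 1)
  have h₂ := coefC_add_add_one (l + 1) d
  rw [show l + (d + 1) + 1 = l + d + 1 + 1 by omega] at h₁
  rw [show l + 1 + d + 1 = l + d + 1 + 1 by omega] at h₂
  rw [h₁, h₂, coefC_add_add_one, Nat.factorial_succ (l + d + 1), Nat.factorial_succ l,
    Nat.factorial_succ d]
  have hfac : ((l + d + 1).factorial : ℚ) ≠ 0 := by positivity
  have hpos : (l + d + 1 + 1 : ℚ) ≠ 0 := by positivity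
  push_cast
  field_simp
  ring

theorem sum_choose_mul_coefC (r k m : ℕ) (h : k < m) :
    ∑ j ∈ Finset.range (r + 1), (r.choose j : ℚ) * coefC (m + r) (j + k) = coefC m k := by
  induction r generalizing m with
  | zero => simp
  | succ r ih =>
    rw [Finset.sum_choose_succ_mul (fun j _ => coefC (m + (r + 1)) (j + k)) r,
      ← Finset.sum_add_distrib, ← ih m h]
    refine Finset.sum_congr rfl fun j hj => ?_
    have hj' : j < r + 1 := Finset.mem_range.mp hj
    rw [← mul_add, ← coefC_add_coefC_succ (show j + k < m + r by omega),
      Nat.add_right_comm j 1 k, ← Nat.add_assoc m r 1]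

/-- For all non-negative integers `r, k, n` with `r + k < n`,
`∑_{j=0}^{r} C(r,j) (j+k)!(n-1-j-k)!/n! = k!(n-r-1-k)!/(n-r)!`; equivalently
`∑_{j=0}^r C(r,j) c(n, j+k) = c(n-r, k)`. -/
theorem binomial_coefC_identity (r k n : ℕ) (h : r + k < n) :
    (∑ j ∈ Finset.range (r + 1), (Nat.choose r j : ℚ) *
        ((Nat.factorial (j + k) * Nat.factorial (n - 1 - j - k) : ℚ) / Nat.factorial n))
      = (Nat.factorial k * Nat.factorial (n - r - 1 - k) : ℚ) / Nat.factorial (n - r) ∧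
    (∑ j ∈ Finset.range (r + 1), (Nat.choose r j : ℚ) * coefC n (j + k)) = coefC (n - r) k := by
  have hk : k < n - r := by omega
  have hsum : ∑ j ∈ Finset.range (r + 1), (Nat.choose r j : ℚ) * coefC n (j + k)
      = coefC (n - r) k := by
    have := sum_choose_mul_coefC r k (n - r) hk
    rwa [Nat.sub_add_cancel (by omega)] at this
  refine ⟨?_, hsum⟩
  rw [coefC, if_pos hk] at hsum
  rw [← hsum]
  refine Finset.sum_congr rfl fun j hj => ?_
  have hj' : j < r + 1 := Finset.mem_range.mp hj
  rw [coefC, if_pos (by omega), Nat.sub_sub (n - 1) j k]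
end
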